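/- arXiv:1803.09900 — 2 statements merged into one kernel-verified Lean document; each statement's English description precedes it below -/
import Mathlib

section
/- The product of two DCSOS polynomials is DCSOS. Explicitly, if p = P₁ − P₂ and q = Q₁ − Q₂ where P₁, P₂, Q₁, Q₂ are CSOS polynomials, then p·q = ½[(P₁ + Q₁)² + (P₂ + Q₂)²] − ½[(P₁ + Q₂)² + (P₂ + Q₁)²], and each of the two bracketed polynomials ½[(P₁+Q₁)² + (P₂+Q₂)²] and ½[(P₁+Q₂)² + (P₂+Q₁)²] is a CSOS polynomial. -/
open MvPolynomial

/-- A polynomial is SOS if it is a finite sum of squares of polynomials. -/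
def IsSOS {n : ℕ} (p : MvPolynomial (Fin n) ℝ) : Prop :=
  ∃ (m : ℕ) (q : Fin m → MvPolynomial (Fin n) ℝ), p = ∑ i, (q i) ^ 2

/-- A polynomial is CSOS if it is SOS and its evaluation function on ℝⁿ is convex. -/
def IsCSOS {n : ℕ} (p : MvPolynomial (Fin n) ℝ) : Prop :=
  IsSOS p ∧ ConvexOn ℝ Set.univ (fun x : Fin n → ℝ => eval x p)

theorem IsSOS.eval_nonneg {n : ℕ} {p : MvPolynomial (Fin n) ℝ} (hp : IsSOS p)
    (x : Fin n → ℝ) : 0 ≤ eval x p := by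
  obtain ⟨m, q, rfl⟩ := hp
  simp only [map_sum, map_pow]
  positivity

theorem isSOS_smul_sq_add_sq {n : ℕ} {c : ℝ} (hc : 0 ≤ c) (a b : MvPolynomial (Fin n) ℝ) :
    IsSOS (c • (a ^ 2 + b ^ 2)) := by
  refine ⟨2, ![√c • a, √c • b], ?_⟩
  simp [Fin.sum_univ_two, smul_pow, Real.sq_sqrt hc]

theorem IsCSOS.convexOn_eval_add_sq {n : ℕ} {p q : MvPolynomial (Fin n) ℝ}
    (hp : IsCSOS p) (hq : IsCSOS q) :
    ConvexOn ℝ Set.univ (fun x : Fin n → ℝ => eval x ((p + q) ^ 2)) := by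
  have h := (hp.2.add hq.2).pow
    (fun x _ => add_nonneg (hp.1.eval_nonneg x) (hq.1.eval_nonneg x)) 2
  refine h.congr fun x _ => ?_
  simp

theorem IsCSOS.smul_add_sq_add_add_sq {n : ℕ} {p q r s : MvPolynomial (Fin n) ℝ}
    (hp : IsCSOS p) (hq : IsCSOS q) (hr : IsCSOS r) (hs : IsCSOS s) {c : ℝ} (hc : 0 ≤ c) :
    IsCSOS (c • ((p + q) ^ 2 + (r + s) ^ 2)) := by
  refine ⟨isSOS_smul_sq_add_sq hc _ _, ?_⟩
  refine (((hp.convexOn_eval_add_sq hq).add (hr.convexOn_eval_add_sq hs)).smul hc).congr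
    fun x _ => ?_
  simp [smul_eval, mul_add]

theorem dcsos_mul_dcsos {n : ℕ} (p q P₁ P₂ Q₁ Q₂ : MvPolynomial (Fin n) ℝ)
    (hP₁ : IsCSOS P₁) (hP₂ : IsCSOS P₂) (hQ₁ : IsCSOS Q₁) (hQ₂ : IsCSOS Q₂)
    (hp : p = P₁ - P₂) (hq : q = Q₁ - Q₂) :
    p * q =
      (1 / 2 : ℝ) • ((P₁ + Q₁) ^ 2 + (P₂ + Q₂) ^ 2) -
      (1 / 2 : ℝ) • ((P₁ + Q₂) ^ 2 + (P₂ + Q₁) ^ 2) ∧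
    IsCSOS ((1 / 2 : ℝ) • ((P₁ + Q₁) ^ 2 + (P₂ + Q₂) ^ 2)) ∧
    IsCSOS ((1 / 2 : ℝ) • ((P₁ + Q₂) ^ 2 + (P₂ + Q₁) ^ 2)) := by
  refine ⟨?_, hP₁.smul_add_sq_add_add_sq hQ₁ hP₂ hQ₂ (by norm_num),
    hP₁.smul_add_sq_add_add_sq hQ₂ hP₂ hQ₁ (by norm_num)⟩
  rw [← smul_sub, hp, hq]
  have h : (P₁ + Q₁) ^ 2 + (P₂ + Q₂) ^ 2 - ((P₁ + Q₂) ^ 2 + (P₂ + Q₁) ^ 2) =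
      (2 : ℝ) • ((P₁ - P₂) * (Q₁ - Q₂)) := by
    rw [ofNat_smul_eq_nsmul ℝ 2, nsmul_eq_mul]
    push_cast
    ring
  rw [h, smul_smul]
  norm_num
end

section
/- For every n ≥ 1 and d ≥ 0, every polynomial p ∈ ℝ[x₁,…,xₙ] of total degree at most 2d can be written as p = s₁ − s₂ where s₁ and s₂ are CSOS polynomials (SOS polynomials whose evaluation functions on ℝⁿ are convex) of total degree at most 2d; that is, ℝ[x]_{2d} = DCSOS_{n,2d}. Consequently every real polynomial is a difference of two convex SOS polynomials. -/
open MvPolynomial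

/-- If a vector-valued polynomial in `t` takes all its values in a subspace, then its coefficients
lie in that subspace. -/
theorem Submodule.mem_of_forall_sum_pow_smul_mem {E : Type*} [AddCommGroup E] [Module ℝ E]
    (M : Submodule ℝ E) (N : ℕ) (a : ℕ → E)
    (h : ∀ t : ℝ, ∑ i ∈ Finset.range N, t ^ i • a i ∈ M) {i : ℕ} (hi : i < N) : a i ∈ M := by
  rw [← Submodule.Quotient.mk_eq_zero, ← Module.forall_dual_apply_eq_zero_iff ℝ]
  intro f
  have hP : ∑ j ∈ Finset.range N, Polynomial.monomial j (f (Submodule.Quotient.mk (a j))) = 0 := by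
    refine Polynomial.funext fun t => ?_
    have ht := congrArg f ((Submodule.Quotient.mk_eq_zero M).2 (h t))
    rw [← Submodule.mkQ_apply] at ht
    simpa [Polynomial.eval_finsetSum, mul_comm] using ht
  simpa [Polynomial.finsetSum_coeff, Polynomial.coeff_monomial, hi] using
    congrArg (fun P => P.coeff i) hP

/-- Polynomials of total degree at most one whose evaluation is an affine map. -/
def affinePolynomials (n : ℕ) : Submodule ℝ (MvPolynomial (Fin n) ℝ) where
  carrier := {l | l.totalDegree ≤ 1 ∧ ∃ g : (Fin n → ℝ) →ᵃ[ℝ] ℝ, ∀ x, eval x l = g x}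
  zero_mem' := ⟨by simp, 0, by simp⟩
  add_mem' := by
    rintro p q ⟨hp, g, hg⟩ ⟨hq, k, hk⟩
    exact ⟨(totalDegree_add p q).trans (max_le hp hq), g + k, fun x => by simp [hg, hk]⟩
  smul_mem' := by
    rintro c p ⟨hp, g, hg⟩
    exact ⟨(totalDegree_smul_le c p).trans hp, c • g, fun x => by simp [smul_eval, hg]⟩

theorem one_mem_affinePolynomials (n : ℕ) : 1 ∈ affinePolynomials n :=
  ⟨by simp, AffineMap.const ℝ _ 1, by simp⟩

theorem X_mem_affinePolynomials {n : ℕ} (i : Fin n) : X i ∈ affinePolynomials n :=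
  ⟨by simp, (LinearMap.proj i).toAffineMap, by simp⟩

/-- The span of the `m`-th powers of the elements of a subspace `A` contains the products of `m`
elements of `A`. -/
theorem Multiset.prod_mul_pow_mem_span_pow {R : Type*} [CommRing R] [Algebra ℝ R]
    (A : Submodule ℝ R) (m : ℕ) (s : Multiset R) (hs : ∀ y ∈ s, y ∈ A) (k : ℕ)
    (hk : Multiset.card s + k = m) {l : R} (hl : l ∈ A) :
    s.prod * l ^ k ∈ Submodule.span ℝ ((fun y => y ^ m) '' (A : Set R)) := by
  induction s using Multiset.induction_on generalizing k l with
  | empty =>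
    obtain rfl : k = m := by simpa using hk
    rw [Multiset.prod_zero, one_mul]
    exact Submodule.subset_span ⟨l, hl, rfl⟩
  | cons v s ih =>
    have hv : v ∈ A := hs v (Multiset.mem_cons_self v s)
    rw [Multiset.card_cons] at hk
    have key := Submodule.mem_of_forall_sum_pow_smul_mem
      (Submodule.span ℝ ((fun y => y ^ m) '' (A : Set R))) (k + 1 + 1)
      (fun i => s.prod * (v ^ i * l ^ (k + 1 - i) * ((k + 1).choose i : R)))
      (fun t => by
        have := ih (fun y hy => hs y (Multiset.mem_cons_of_mem hy)) (k + 1) (by omega)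
          (A.add_mem (A.smul_mem t hv) hl)
        rw [add_pow, Finset.mul_sum] at this
        convert this using 2
        simp [smul_pow]) (i := 1) (by omega)
    have hne : ((k + 1 : ℕ) : ℝ) ≠ 0 := by positivity
    convert Submodule.smul_mem _ ((k + 1 : ℕ) : ℝ)⁻¹ key using 1
    rw [eq_inv_smul_iff₀ hne, Algebra.smul_def]
    simp
    ring

theorem monomial_mem_span_pow {n m : ℕ} (v : Fin n →₀ ℕ) (c : ℝ) (hv : v.degree ≤ m) :
    monomial v c ∈ Submodule.span ℝ ((fun y => y ^ m) '' (affinePolynomials n : Set _)) := by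
  have h := Multiset.prod_mul_pow_mem_span_pow (affinePolynomials n) m
    (v.toMultiset.map X) (by
      intro y hy
      obtain ⟨i, -, rfl⟩ := Multiset.mem_map.1 hy
      exact X_mem_affinePolynomials i) (m - v.degree)
    (by
      have : Multiset.card v.toMultiset = v.degree := by
        rw [Finsupp.card_toMultiset]; rfl
      rw [Multiset.card_map, this]; omega)
    (one_mem_affinePolynomials n)
  convert Submodule.smul_mem _ c h using 1
  rw [one_pow, mul_one, Finsupp.toMultiset_map, Finsupp.prod_toMultiset, monomial_eq, smul_eq_C_mul,
    Finsupp.prod_mapDomain_index (by simp) (by simp [pow_add])]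

theorem mem_span_pow_of_totalDegree_le {n m : ℕ} {p : MvPolynomial (Fin n) ℝ}
    (hp : p.totalDegree ≤ m) :
    p ∈ Submodule.span ℝ ((fun y => y ^ m) '' (affinePolynomials n : Set _)) := by
  rw [p.as_sum]
  exact Submodule.sum_mem _ fun v hv =>
    monomial_mem_span_pow v _ ((le_totalDegree hv).trans hp)

theorem IsSOS.add {n : ℕ} {p q : MvPolynomial (Fin n) ℝ} (hp : IsSOS p) (hq : IsSOS q) :
    IsSOS (p + q) := by
  obtain ⟨a, f, rfl⟩ := hp
  obtain ⟨b, g, rfl⟩ := hq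
  exact ⟨a + b, Fin.append f g, by simp [Fin.sum_univ_add]⟩

theorem IsSOS.smul {n : ℕ} {p : MvPolynomial (Fin n) ℝ} (hp : IsSOS p) {c : ℝ} (hc : 0 ≤ c) :
    IsSOS (c • p) := by
  obtain ⟨a, f, rfl⟩ := hp
  exact ⟨a, fun i => √c • f i, by simp [smul_pow, Real.sq_sqrt hc, Finset.smul_sum]⟩

theorem IsCSOS.zero {n : ℕ} : IsCSOS (0 : MvPolynomial (Fin n) ℝ) :=
  ⟨⟨0, Fin.elim0, by simp⟩, by simpa using convexOn_const (0 : ℝ) convex_univ⟩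

theorem IsCSOS.add {n : ℕ} {p q : MvPolynomial (Fin n) ℝ} (hp : IsCSOS p) (hq : IsCSOS q) :
    IsCSOS (p + q) :=
  ⟨hp.1.add hq.1, by simp only [map_add]; exact hp.2.add hq.2⟩

theorem IsCSOS.smul {n : ℕ} {p : MvPolynomial (Fin n) ℝ} (hp : IsCSOS p) {c : ℝ} (hc : 0 ≤ c) :
    IsCSOS (c • p) :=
  ⟨hp.1.smul hc, by simp only [smul_eval]; exact hp.2.smul hc⟩

theorem isCSOS_pow_of_mem_affinePolynomials {n d : ℕ} {l : MvPolynomial (Fin n) ℝ}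
    (hl : l ∈ affinePolynomials n) : IsCSOS (l ^ (2 * d)) := by
  obtain ⟨-, g, hg⟩ := hl
  refine ⟨⟨1, fun _ => l ^ d, by simp [← pow_mul, mul_comm]⟩, ?_⟩
  simpa [hg, Function.comp_def] using
    ((even_two_mul d).convexOn_pow (𝕜 := ℝ)).comp_affineMap g

/-- The polynomials that are differences of two CSOS polynomials of total degree at most `m`. -/
def differencesOfCSOS (n m : ℕ) : Submodule ℝ (MvPolynomial (Fin n) ℝ) where
  carrier := {p | ∃ s₁ s₂ : MvPolynomial (Fin n) ℝ, IsCSOS s₁ ∧ IsCSOS s₂ ∧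
    s₁.totalDegree ≤ m ∧ s₂.totalDegree ≤ m ∧ p = s₁ - s₂}
  zero_mem' := ⟨0, 0, .zero, .zero, by simp, by simp, by simp⟩
  add_mem' := by
    rintro p q ⟨s₁, s₂, h₁, h₂, hd₁, hd₂, rfl⟩ ⟨t₁, t₂, k₁, k₂, kd₁, kd₂, rfl⟩
    exact ⟨s₁ + t₁, s₂ + t₂, h₁.add k₁, h₂.add k₂,
      (totalDegree_add _ _).trans (max_le hd₁ kd₁),
      (totalDegree_add _ _).trans (max_le hd₂ kd₂), by ring⟩
  smul_mem' := by
    rintro c p ⟨s₁, s₂, h₁, h₂, hd₁, hd₂, rfl⟩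
    rcases le_total 0 c with hc | hc
    · exact ⟨c • s₁, c • s₂, h₁.smul hc, h₂.smul hc, (totalDegree_smul_le _ _).trans hd₁,
        (totalDegree_smul_le _ _).trans hd₂, smul_sub _ _ _⟩
    · have hc' : 0 ≤ -c := neg_nonneg.2 hc
      exact ⟨-c • s₂, -c • s₁, h₂.smul hc', h₁.smul hc', (totalDegree_smul_le _ _).trans hd₂,
        (totalDegree_smul_le _ _).trans hd₁, by module⟩

theorem span_pow_le_differencesOfCSOS (n d : ℕ) :
    Submodule.span ℝ ((fun y => y ^ (2 * d)) '' (affinePolynomials n : Set _)) ≤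
      differencesOfCSOS n (2 * d) := by
  rw [Submodule.span_le]
  rintro _ ⟨l, hl, rfl⟩
  refine ⟨l ^ (2 * d), 0, isCSOS_pow_of_mem_affinePolynomials hl, .zero, ?_, by simp, by simp⟩
  exact (totalDegree_pow _ _).trans (by simpa using Nat.mul_le_mul_left (2 * d) hl.1)

theorem poly_eq_dcsos {n : ℕ} (hn : 1 ≤ n) (d : ℕ) :
    (∀ p : MvPolynomial (Fin n) ℝ, p.totalDegree ≤ 2 * d →
      ∃ s₁ s₂ : MvPolynomial (Fin n) ℝ, IsCSOS s₁ ∧ IsCSOS s₂ ∧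
        s₁.totalDegree ≤ 2 * d ∧ s₂.totalDegree ≤ 2 * d ∧ p = s₁ - s₂) ∧
    (∀ p : MvPolynomial (Fin n) ℝ,
      ∃ s₁ s₂ : MvPolynomial (Fin n) ℝ, IsCSOS s₁ ∧ IsCSOS s₂ ∧ p = s₁ - s₂) := by
  refine ⟨fun p hp => span_pow_le_differencesOfCSOS n d (mem_span_pow_of_totalDegree_le hp),
    fun p => ?_⟩
  obtain ⟨s₁, s₂, h₁, h₂, -, -, h⟩ := span_pow_le_differencesOfCSOS n p.totalDegree
    (mem_span_pow_of_totalDegree_le (p := p) (by omega))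
  exact ⟨s₁, s₂, h₁, h₂, h⟩
end
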